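/- arXiv:1710.03057 — 2 statements merged into one kernel-verified Lean document; each statement's English description precedes it below -/
import Mathlib

section
/- Let H be an infinite-dimensional real Hilbert space and let ℓ be a continuous linear functional on B(H) with ℓ(𝟙) = 1 and ℓ(K) = 0 for every compact operator K. For a smooth function f : H → ℝ, let A_{f''_0} ∈ B(H) be the operator representing the second Fréchet derivative of f at 0 via f''_0(v,w) = ⟨A_{f''_0}v, w⟩, and set δ_ℓ(f) := ℓ(A_{f''_0}). Then δ_ℓ(ρ) = 2 for ρ(v) = ⟨v,v⟩, while the differential of ρ at 0 vanishes; consequently there is no continuous linear functional L on H* such that δ_ℓ(f) = L(Df(0)) for all smooth f : H → ℝ. In particular δ_ℓ is a queer (order ≥ 2) operational tangent vector at 0, not a kinematic one. -/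
/-- The bounded operator `A` representing a bounded bilinear form `B` on a real
Hilbert space via `B(v,w) = ⟨A v, w⟩` (using the Riesz representation). -/
noncomputable def bilinToOp {H : Type*} [NormedAddCommGroup H] [InnerProductSpace ℝ H]
    [CompleteSpace H] (B : H →L[ℝ] H →L[ℝ] ℝ) : H →L[ℝ] H :=
  (InnerProductSpace.toDual ℝ H).symm.toContinuousLinearEquiv.toContinuousLinearMap.comp B

theorem fderiv_inner_self {H : Type*} [NormedAddCommGroup H] [InnerProductSpace ℝ H] :
    fderiv ℝ (fun v : H => (inner ℝ v v : ℝ)) = ⇑((2 : ℝ) • innerSL ℝ : H →L[ℝ] H →L[ℝ] ℝ) := by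
  ext x y
  rw [fderiv_inner_apply ℝ differentiableAt_fun_id differentiableAt_fun_id]
  simp [real_inner_comm, two_mul]

theorem bilinToOp_two_smul_innerSL {H : Type*} [NormedAddCommGroup H] [InnerProductSpace ℝ H]
    [CompleteSpace H] :
    bilinToOp ((2 : ℝ) • innerSL ℝ : H →L[ℝ] H →L[ℝ] ℝ) =
      (2 : ℝ) • ContinuousLinearMap.id ℝ H := by
  ext x
  refine (InnerProductSpace.toDual ℝ H).symm_apply_eq.mpr ?_
  ext y
  simp [innerSL_apply_apply ℝ]

/-- Let `H` be an infinite-dimensional real Hilbert space and `ℓ` a continuous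
linear functional on `B(H)` with `ℓ(𝟙) = 1` vanishing on compact operators, and
let `δ_ℓ(f) := ℓ(A_{f''_0})`.  Then `δ_ℓ(ρ) = 2` for `ρ(v) = ⟨v,v⟩` while
`Dρ(0) = 0`; consequently no continuous linear functional `L` on `H*` satisfies
`δ_ℓ(f) = L(Df(0))` for all smooth `f`: `δ_ℓ` is a queer, non-kinematic
operational tangent vector at `0`. -/
theorem delta_ell_is_queer
    {H : Type*} [NormedAddCommGroup H] [InnerProductSpace ℝ H] [CompleteSpace H]
    (hinf : ¬ FiniteDimensional ℝ H)
    (ℓ : (H →L[ℝ] H) →L[ℝ] ℝ)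
    (hid : ℓ (ContinuousLinearMap.id ℝ H) = 1)
    (hcpt : ∀ K : H →L[ℝ] H, IsCompactOperator K → ℓ K = 0) :
    ℓ (bilinToOp (fderiv ℝ (fderiv ℝ (fun v : H => (inner ℝ v v : ℝ))) 0)) = 2 ∧
    fderiv ℝ (fun v : H => (inner ℝ v v : ℝ)) 0 = 0 ∧
    ¬ ∃ L : (H →L[ℝ] ℝ) →L[ℝ] ℝ, ∀ f : H → ℝ, ContDiff ℝ (⊤ : ℕ∞) f →
      ℓ (bilinToOp (fderiv ℝ (fderiv ℝ f) 0)) = L (fderiv ℝ f 0) := by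
  have hsecond :
      ℓ (bilinToOp (fderiv ℝ (fderiv ℝ (fun v : H => (inner ℝ v v : ℝ))) 0)) = 2 := by
    rw [fderiv_inner_self, ContinuousLinearMap.fderiv, bilinToOp_two_smul_innerSL, map_smul, hid,
      smul_eq_mul, mul_one]
  have hfirst : fderiv ℝ (fun v : H => (inner ℝ v v : ℝ)) 0 = 0 := by
    rw [fderiv_inner_self, map_zero]
  refine ⟨hsecond, hfirst, ?_⟩
  rintro ⟨L, hL⟩
  have h := hL (fun v => inner ℝ v v) (contDiff_id.inner ℝ contDiff_id)
  rw [hsecond, hfirst, map_zero] at h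
  exact two_ne_zero h
end

section
/- Let H be an infinite-dimensional real Hilbert space and let ℓ be a continuous linear functional on B(H) with ℓ(𝟙) = 1 and ℓ(K) = 0 for all compact K; let δ_ℓ(f) := ℓ(A_{f''_0}) as above, so δ_ℓ(ρ) = 2 for ρ(v) = ⟨v,v⟩. Suppose D₀ : C^∞(H,ℝ) → C^∞(H,ℝ), D₁ : C^∞(H,H*) → C^∞(H,H*), and D₂ : C^∞(H,H) → C^∞(H,H) are maps satisfying the Leibniz rule for the duality pairing B(φ,v) = φ(v): D₀(v ↦ B(f(v), g(v))) = (v ↦ B((D₁f)(v), g(v)) + B(f(v), (D₂g)(v))) for all smooth f : H → H* and g : H → H. Then D₀(ρ)(0) = 0 ≠ 2 = δ_ℓ(ρ). Consequently, the queer operational vector field δ_ℓ cannot be extended to a derivation (in the sense of the Leibniz rule for bilinear pairings) acting on vector-valued smooth functions. -/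
/-- The Hessian of `v ↦ ⟨v, v⟩` is represented by twice the identity. -/
theorem bilinToOp_fderiv_fderiv_inner_self {H : Type*} [NormedAddCommGroup H]
    [InnerProductSpace ℝ H] [CompleteSpace H] (x : H) :
    bilinToOp (fderiv ℝ (fderiv ℝ (fun v : H => (inner ℝ v v : ℝ))) x) =
      (2 : ℝ) • ContinuousLinearMap.id ℝ H := by
  have h1 : fderiv ℝ (fun v : H => (inner ℝ v v : ℝ)) =
      ((2 : ℝ) • (innerSL ℝ : H →L[ℝ] H →L[ℝ] ℝ) : H →L[ℝ] H →L[ℝ] ℝ) := by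
    ext v w
    rw [fderiv_inner_apply ℝ differentiableAt_fun_id differentiableAt_fun_id]
    simp [real_inner_comm, two_mul]
  rw [h1, ContinuousLinearMap.fderiv]
  ext v
  refine (InnerProductSpace.toDual ℝ H).symm_apply_eq.mpr ?_
  ext w
  simp
  exact innerSL_apply_apply ℝ v w

/-- The queer operational vector field `δ_ℓ` (with `ℓ(𝟙) = 1`, `ℓ` vanishing on
compact operators) cannot be extended to a derivation on vector-valued smooth
maps satisfying the Leibniz rule for the duality pairing `B(φ,v) = φ(v)`:
any maps `D₀, D₁, D₂` satisfying that Leibniz rule give `D₀(ρ)(0) = 0`,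
whereas `δ_ℓ(ρ) = 2`, for `ρ(v) = ⟨v,v⟩`. -/
theorem no_extension_to_derivation
    {H : Type*} [NormedAddCommGroup H] [InnerProductSpace ℝ H] [CompleteSpace H]
    (hinf : ¬ FiniteDimensional ℝ H)
    (ℓ : (H →L[ℝ] H) →L[ℝ] ℝ)
    (hid : ℓ (ContinuousLinearMap.id ℝ H) = 1)
    (hcpt : ∀ K : H →L[ℝ] H, IsCompactOperator K → ℓ K = 0)
    (D₀ : (H → ℝ) → (H → ℝ))
    (D₁ : (H → (H →L[ℝ] ℝ)) → (H → (H →L[ℝ] ℝ)))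
    (D₂ : (H → H) → (H → H))
    (hleib : ∀ (f : H → (H →L[ℝ] ℝ)) (g : H → H),
      ContDiff ℝ (⊤ : ℕ∞) f → ContDiff ℝ (⊤ : ℕ∞) g →
      D₀ (fun v => f v (g v)) = fun v => D₁ f v (g v) + f v (D₂ g v)) :
    D₀ (fun v : H => (inner ℝ v v : ℝ)) 0 = 0 ∧
    ℓ (bilinToOp (fderiv ℝ (fderiv ℝ (fun v : H => (inner ℝ v v : ℝ))) 0)) = 2 := by
  constructor
  · have hf : ContDiff ℝ (⊤ : ℕ∞) (fun v : H => (innerSL ℝ v : H →L[ℝ] ℝ)) :=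
      (innerSL ℝ : H →L[ℝ] H →L[ℝ] ℝ).contDiff
    have h := congrFun (hleib (fun v => innerSL ℝ v) id hf contDiff_id) 0
    simpa using h
  · rw [bilinToOp_fderiv_fderiv_inner_self, map_smul, hid]
    norm_num
end
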